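/- arXiv:1312.0256 — 6 statements merged into one kernel-verified Lean document; each statement's English description precedes it below -/
import Mathlib

section
/- For every h > 0 and Q̂ > 0, ∫_ℝ φ(z√h; Q̂) · e^{−z²/2}/√(2π) dz = r(h)/Q̂. -/
open MeasureTheory

/-- Standard Gaussian tail function `𝒬(x) = ∫_x^∞ e^{−z²/2}/√(2π) dz`. -/
noncomputable def gaussQ (x : ℝ) : ℝ :=
  ∫ z in Set.Ioi x, Real.exp (-z ^ 2 / 2) / Real.sqrt (2 * Real.pi)

/-- `r(h) = √(h/(2π))·e^{−1/(2h)} − (1+h)·𝒬(1/√h)`. -/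
noncomputable def rFun (h : ℝ) : ℝ :=
  Real.sqrt (h / (2 * Real.pi)) * Real.exp (-1 / (2 * h)) - (1 + h) * gaussQ (1 / Real.sqrt h)

/-- `φ(y; Q̂) = −(|y|−1)²/(2Q̂)` if `|y| > 1` and `0` otherwise. -/
noncomputable def phiFun (y Qh : ℝ) : ℝ :=
  if 1 < |y| then -(|y| - 1) ^ 2 / (2 * Qh) else 0

/-- The unnormalised Gaussian weight has all polynomial moments. -/
lemma integrable_pow_mul_exp_neg_sq_div_two (n : ℕ) :
    Integrable fun z : ℝ => z ^ n * Real.exp (-z ^ 2 / 2) := by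
  have h := integrable_rpow_mul_exp_neg_mul_sq (b := 1 / 2) (by norm_num) (s := (n : ℝ))
    (by have := Nat.cast_nonneg (α := ℝ) n; linarith)
  refine h.congr (Filter.Eventually.of_forall fun z => ?_)
  simp only [Real.rpow_natCast]
  congr 2
  ring

/-- A quadratic polynomial is integrable against the Gaussian weight. -/
lemma integrable_quadratic_mul_exp_neg_sq_div_two (a b c : ℝ) :
    Integrable fun z : ℝ => (a * z ^ 2 + b * z + c) * Real.exp (-z ^ 2 / 2) := by
  refine ((((integrable_pow_mul_exp_neg_sq_div_two 2).const_mul a).add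
    ((integrable_pow_mul_exp_neg_sq_div_two 1).const_mul b)).add
    ((integrable_pow_mul_exp_neg_sq_div_two 0).const_mul c)).congr
    (Filter.Eventually.of_forall fun z => ?_)
  simp only [Pi.add_apply]
  ring

/-- Truncated second moment of a quadratic against the Gaussian weight, by parts. -/
lemma integral_Ioi_deriv_linear_mul_exp (a b c : ℝ) :
    ∫ z in Set.Ioi a, (b * z ^ 2 + c * z - b) * Real.exp (-z ^ 2 / 2) =
      (b * a + c) * Real.exp (-a ^ 2 / 2) := by
  have hderiv : ∀ z : ℝ, HasDerivAt (fun z : ℝ => -(b * z + c) * Real.exp (-z ^ 2 / 2))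
      ((b * z ^ 2 + c * z - b) * Real.exp (-z ^ 2 / 2)) z := by
    intro z
    have h1 : HasDerivAt (fun z : ℝ => -(b * z + c)) (-b) z := by
      simpa using (((hasDerivAt_id z).const_mul b).add_const c).fun_neg
    have h2 : HasDerivAt (fun z : ℝ => -z ^ 2 / 2) (-z) z := by
      refine ((hasDerivAt_pow 2 z).fun_neg.div_const 2).congr_deriv ?_
      norm_num
      ring
    refine (h1.mul h2.exp).congr_deriv ?_
    ring
  have hInt : Integrable fun z : ℝ => -(b * z + c) * Real.exp (-z ^ 2 / 2) := by
    simpa [add_comm] using integrable_quadratic_mul_exp_neg_sq_div_two 0 (-b) (-c)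
  have hderivInt : Integrable fun z : ℝ => (b * z ^ 2 + c * z - b) * Real.exp (-z ^ 2 / 2) := by
    simpa [sub_eq_add_neg] using integrable_quadratic_mul_exp_neg_sq_div_two b c (-b)
  rw [integral_Ioi_of_hasDerivAt_of_tendsto' (fun z _ => hderiv z) hderivInt.integrableOn
    (tendsto_zero_of_hasDerivAt_of_integrableOn_Ioi (a := a) (fun z _ => hderiv z)
      hderivInt.integrableOn hInt.integrableOn)]
  ring

/-- `∫_ℝ φ(z√h; Q̂)·e^{−z²/2}/√(2π) dz = r(h)/Q̂` for `h > 0`, `Q̂ > 0`. -/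
theorem stmt_1 (h Qh : ℝ) (hh : 0 < h) (hQ : 0 < Qh) :
    ∫ z : ℝ, phiFun (z * Real.sqrt h) Qh * (Real.exp (-z ^ 2 / 2) / Real.sqrt (2 * Real.pi)) =
      rFun h / Qh := by
  have hs : 0 < Real.sqrt h := Real.sqrt_pos.2 hh
  have hss : Real.sqrt h ^ 2 = h := Real.sq_sqrt hh.le
  have hp : 0 < Real.sqrt (2 * Real.pi) := Real.sqrt_pos.2 (by positivity)
  rw [rFun, gaussQ, Real.sqrt_div hh.le]
  set s := Real.sqrt h
  set p := Real.sqrt (2 * Real.pi)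
  have habs : ∀ z : ℝ, phiFun (z * s) Qh * (Real.exp (-z ^ 2 / 2) / p) =
      (fun y => phiFun (y * s) Qh * (Real.exp (-y ^ 2 / 2) / p)) |z| := by
    intro z
    simp [phiFun, abs_mul]
  have hind : (fun z : ℝ => phiFun (z * s) Qh * (Real.exp (-z ^ 2 / 2) / p)) =ᵐ[
      volume.restrict (Set.Ioi 0)] (Set.Ioi (1 / s)).indicator fun z =>
        (-1 / (2 * Qh * p)) * ((h * z ^ 2 + (-2 * s) * z - h) * Real.exp (-z ^ 2 / 2)) +
          (-(1 + h) / (2 * Qh)) * (Real.exp (-z ^ 2 / 2) / p) := by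
    refine (ae_restrict_iff' measurableSet_Ioi).2 (Filter.Eventually.of_forall fun z hz => ?_)
    have hz' : |z * s| = z * s := abs_of_pos (mul_pos hz hs)
    simp only [phiFun, hz', Set.indicator_apply, Set.mem_Ioi, div_lt_iff₀ hs]
    split_ifs
    · rw [← hss]
      field_simp
      ring
    · simp
  have hexp : Integrable fun z : ℝ => Real.exp (-z ^ 2 / 2) := by
    simpa using integrable_pow_mul_exp_neg_sq_div_two 0
  have hquad : Integrable fun z : ℝ =>
      (h * z ^ 2 + (-2 * s) * z - h) * Real.exp (-z ^ 2 / 2) := by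
    simpa [sub_eq_add_neg] using integrable_quadratic_mul_exp_neg_sq_div_two h (-2 * s) (-h)
  have hsub : Set.Ioi (0 : ℝ) ∩ Set.Ioi (1 / s) = Set.Ioi (1 / s) :=
    Set.inter_eq_right.2 (Set.Ioi_subset_Ioi (by positivity))
  have hsq : -(1 / s) ^ 2 / 2 = -1 / (2 * h) := by
    rw [← hss]
    field_simp
  rw [integral_congr_ae (Filter.Eventually.of_forall habs),
    integral_comp_abs (f := fun y => phiFun (y * s) Qh * (Real.exp (-y ^ 2 / 2) / p)),
    integral_congr_ae hind, setIntegral_indicator measurableSet_Ioi, hsub,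
    integral_add (hquad.const_mul _).integrableOn ((hexp.div_const p).const_mul _).integrableOn,
    integral_const_mul, integral_const_mul, integral_Ioi_deriv_linear_mul_exp, hsq]
  have hlin : h * (1 / s) + -2 * s = -s := by
    rw [← hss]
    field_simp
    ring
  rw [hlin]
  field_simp
  ring
end

section
/- Let ρ ∈ [0,1], m̂ > 0 and χ̂ > 0. Let x⁰ be distributed according to the Bernoulli–Gaussian measure μ_ρ and let z be an independent standard Gaussian random variable. Then E[ x⁰ · x̂(√χ̂·z + m̂·x⁰; m̂) ] = 2ρ·𝒬(1/√(χ̂ + m̂²)). -/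
open MeasureTheory ProbabilityTheory

/-- Soft-thresholding function: `x̂(y; Q̂)`. -/
noncomputable def softThresh (y Qh : ℝ) : ℝ :=
  if 1 < y then (y - 1) / Qh else if y < -1 then (y + 1) / Qh else 0

/-- Bernoulli–Gaussian measure `μ_ρ = (1−ρ)·δ₀ + ρ·N(0,1)` on `ℝ`. -/
noncomputable def bgMeasure (ρ : ℝ) : Measure ℝ :=
  ENNReal.ofReal (1 - ρ) • Measure.dirac (0 : ℝ) + ENNReal.ofReal ρ • gaussianReal 0 1

lemma hasDerivAt_mul_exp_neg_sq_half (a x : ℝ) :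
    HasDerivAt (fun x : ℝ => -(x - a) * Real.exp (-x ^ 2 / 2))
      (x * (x - a) * Real.exp (-x ^ 2 / 2) - Real.exp (-x ^ 2 / 2)) x := by
  have h1 : HasDerivAt (fun x : ℝ => -x ^ 2 / 2) (-x) x :=
    ((hasDerivAt_pow 2 x).fun_neg.div_const 2).congr_deriv (by norm_num; ring)
  refine (((hasDerivAt_id' x).sub_const a).fun_neg.fun_mul h1.exp).congr_deriv ?_
  ring

lemma integrable_exp_neg_sq_half : Integrable fun x : ℝ => Real.exp (-x ^ 2 / 2) := by
  convert integrable_exp_neg_mul_sq (b := 1 / 2) (by norm_num) using 3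
  ring

lemma integrable_mul_sub_mul_exp_neg_sq_half (a : ℝ) :
    Integrable fun x : ℝ => x * (x - a) * Real.exp (-x ^ 2 / 2) := by
  have h1 := integrable_mul_exp_neg_mul_sq (b := 1 / 2) (by norm_num)
  have h2 := integrable_rpow_mul_exp_neg_mul_sq (b := 1 / 2) (by norm_num) (s := 2) (by norm_num)
  convert h2.sub (h1.const_mul a) using 2 with x
  have : -x ^ 2 / 2 = -(1 / 2) * x ^ 2 := by ring
  simp only [Real.rpow_two, Pi.sub_apply, this]
  ring

lemma integrable_sub_mul_exp_neg_sq_half (a : ℝ) :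
    Integrable fun x : ℝ => -(x - a) * Real.exp (-x ^ 2 / 2) := by
  have h1 := integrable_mul_exp_neg_mul_sq (b := 1 / 2) (by norm_num)
  convert (integrable_exp_neg_sq_half.const_mul a).sub h1 using 2 with x
  have : -x ^ 2 / 2 = -(1 / 2) * x ^ 2 := by ring
  simp only [Pi.sub_apply, this]
  ring

lemma integral_Ioi_mul_sub_mul_exp (a : ℝ) :
    ∫ x in Set.Ioi a, x * (x - a) * Real.exp (-x ^ 2 / 2) =
      ∫ x in Set.Ioi a, Real.exp (-x ^ 2 / 2) := by
  have hi := integrable_mul_sub_mul_exp_neg_sq_half a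
  have hd := hi.sub integrable_exp_neg_sq_half
  have ht := tendsto_zero_of_hasDerivAt_of_integrableOn_Ioi (a := a)
    (fun x _ => hasDerivAt_mul_exp_neg_sq_half a x) hd.integrableOn
    (integrable_sub_mul_exp_neg_sq_half a).integrableOn
  have h := integral_Ioi_of_hasDerivAt_of_tendsto' (a := a)
    (fun x _ => hasDerivAt_mul_exp_neg_sq_half a x) hd.integrableOn ht
  rw [integral_sub hi.integrableOn integrable_exp_neg_sq_half.integrableOn] at h
  simp at h
  linarith

lemma integral_Iio_mul_sub_mul_exp (a : ℝ) :
    ∫ x in Set.Iio a, x * (x - a) * Real.exp (-x ^ 2 / 2) =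
      ∫ x in Set.Iio a, Real.exp (-x ^ 2 / 2) := by
  rw [← integral_Iic_eq_integral_Iio, ← integral_Iic_eq_integral_Iio]
  have hi := integrable_mul_sub_mul_exp_neg_sq_half a
  have hd := hi.sub integrable_exp_neg_sq_half
  have ht := tendsto_zero_of_hasDerivAt_of_integrableOn_Iic (a := a)
    (fun x _ => hasDerivAt_mul_exp_neg_sq_half a x) hd.integrableOn
    (integrable_sub_mul_exp_neg_sq_half a).integrableOn
  have h := integral_Iic_of_hasDerivAt_of_tendsto' (a := a)
    (fun x _ => hasDerivAt_mul_exp_neg_sq_half a x) hd.integrableOn ht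
  rw [integral_sub hi.integrableOn integrable_exp_neg_sq_half.integrableOn] at h
  simp at h
  linarith

lemma gaussianPDFReal_zero_one (x : ℝ) :
    gaussianPDFReal 0 1 x = (Real.sqrt (2 * Real.pi))⁻¹ * Real.exp (-x ^ 2 / 2) := by
  simp [gaussianPDFReal]

lemma setIntegral_gaussianReal_zero_one {s : Set ℝ} (hs : MeasurableSet s) (f : ℝ → ℝ) :
    ∫ x in s, f x ∂gaussianReal 0 1 =
      (Real.sqrt (2 * Real.pi))⁻¹ * ∫ x in s, f x * Real.exp (-x ^ 2 / 2) := by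
  rw [← integral_indicator hs, integral_gaussianReal_eq_integral_smul one_ne_zero,
    ← integral_const_mul, ← integral_indicator hs]
  refine integral_congr_ae (.of_forall fun x => ?_)
  by_cases hx : x ∈ s
  · simp only [Set.indicator_of_mem hx, gaussianPDFReal_zero_one, smul_eq_mul]
    ring
  · simp [hx]

lemma measureReal_gaussianReal_zero_one {s : Set ℝ} (hs : MeasurableSet s) :
    (gaussianReal 0 1).real s =
      (Real.sqrt (2 * Real.pi))⁻¹ * ∫ x in s, Real.exp (-x ^ 2 / 2) := by
  simpa using setIntegral_gaussianReal_zero_one hs (fun _ => 1)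

lemma measureReal_gaussianReal_Ioi (a : ℝ) :
    (gaussianReal 0 1).real (Set.Ioi a) = gaussQ a := by
  rw [measureReal_gaussianReal_zero_one measurableSet_Ioi, gaussQ, integral_div]
  ring

lemma integrable_mul_sub_gaussianReal (a : ℝ) :
    Integrable (fun x : ℝ => x * (x - a)) (gaussianReal 0 1) := by
  have h1 : MemLp (fun x : ℝ => x) 2 (gaussianReal 0 1) := memLp_id_gaussianReal 2
  exact h1.integrable_mul (h1.sub (memLp_const a))

lemma mul_softThresh_eq {m : ℝ} (hm : 0 < m) (c x : ℝ) :
    x * softThresh (c + m * x) m =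
      (Set.Ioi ((1 - c) / m)).indicator (fun x => x * (x - (1 - c) / m)) x +
      (Set.Iio ((-1 - c) / m)).indicator (fun x => x * (x - (-1 - c) / m)) x := by
  have e1 : x ∈ Set.Ioi ((1 - c) / m) ↔ 1 < c + m * x := by
    rw [Set.mem_Ioi, div_lt_iff₀ hm]
    constructor <;> intro <;> linarith
  have e2 : x ∈ Set.Iio ((-1 - c) / m) ↔ c + m * x < -1 := by
    rw [Set.mem_Iio, lt_div_iff₀ hm]
    constructor <;> intro <;> linarith
  unfold softThresh
  simp only [Set.indicator_apply, e1, e2]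
  split_ifs
  · linarith
  · field_simp
    ring
  · field_simp
    ring
  · simp

/-- Gaussian integration by parts for the soft-thresholding function. -/
lemma integral_mul_softThresh_gaussianReal {m : ℝ} (hm : 0 < m) (c : ℝ) :
    ∫ x, x * softThresh (c + m * x) m ∂gaussianReal 0 1 =
      (gaussianReal 0 1).real {x | 1 < c + m * x} +
        (gaussianReal 0 1).real {x | c + m * x < -1} := by
  have s1 : {x | 1 < c + m * x} = Set.Ioi ((1 - c) / m) := by
    ext x
    rw [Set.mem_Ioi, div_lt_iff₀ hm, Set.mem_ofPred_eq]
    constructor <;> intro <;> linarith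
  have s2 : {x | c + m * x < -1} = Set.Iio ((-1 - c) / m) := by
    ext x
    rw [Set.mem_Iio, lt_div_iff₀ hm, Set.mem_ofPred_eq]
    constructor <;> intro <;> linarith
  simp_rw [mul_softThresh_eq hm]
  rw [integral_add ((integrable_mul_sub_gaussianReal _).indicator measurableSet_Ioi)
    ((integrable_mul_sub_gaussianReal _).indicator measurableSet_Iio),
    integral_indicator measurableSet_Ioi, integral_indicator measurableSet_Iio,
    setIntegral_gaussianReal_zero_one measurableSet_Ioi,
    setIntegral_gaussianReal_zero_one measurableSet_Iio,
    integral_Ioi_mul_sub_mul_exp, integral_Iio_mul_sub_mul_exp, s1, s2,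
    measureReal_gaussianReal_zero_one measurableSet_Ioi,
    measureReal_gaussianReal_zero_one measurableSet_Iio]

lemma measurable_softThresh (m : ℝ) : Measurable fun y => softThresh y m := by
  unfold softThresh
  exact Measurable.ite measurableSet_Ioi (by fun_prop)
    (Measurable.ite measurableSet_Iio (by fun_prop) measurable_const)

lemma abs_softThresh_le {m : ℝ} (hm : 0 < m) (y : ℝ) : |softThresh y m| ≤ |y| / m := by
  unfold softThresh
  split_ifs with h1 h2
  · rw [abs_div, abs_of_pos hm, abs_of_pos (by linarith), abs_of_pos (by linarith)]
    gcongr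
    linarith
  · rw [abs_div, abs_of_pos hm, abs_of_neg (by linarith), abs_of_neg (by linarith)]
    gcongr
    linarith
  · simp only [abs_zero]
    positivity

lemma integrable_mul_softThresh_prod {m : ℝ} (hm : 0 < m) (s : ℝ) :
    Integrable (fun p : ℝ × ℝ => p.1 * softThresh (s * p.2 + m * p.1) m)
      ((gaussianReal 0 1).prod (gaussianReal 0 1)) := by
  have h0 : MemLp (fun x : ℝ => x) 2 (gaussianReal 0 1) := memLp_id_gaussianReal 2
  have hx : MemLp (fun p : ℝ × ℝ => p.1) 2 ((gaussianReal 0 1).prod (gaussianReal 0 1)) :=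
    h0.comp_fst _
  have hz : MemLp (fun p : ℝ × ℝ => p.2) 2 ((gaussianReal 0 1).prod (gaussianReal 0 1)) :=
    h0.comp_snd _
  have hy := ((hz.const_mul s).add (hx.const_mul m)).const_mul m⁻¹
  refine (hx.integrable_mul hy).mono ?_ (.of_forall fun p => ?_)
  · exact (measurable_fst.mul ((measurable_softThresh m).comp (by fun_prop))).aestronglyMeasurable
  · simp only [Pi.mul_apply, Pi.add_apply, norm_mul, Real.norm_eq_abs, abs_inv, abs_of_pos hm]
    refine mul_le_mul_of_nonneg_left ((abs_softThresh_le hm _).trans_eq ?_) (abs_nonneg _)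
    ring

lemma map_linear_gaussianReal_prod (a b : ℝ) :
    ((gaussianReal 0 1).prod (gaussianReal 0 1)).map (fun p : ℝ × ℝ => a * p.2 + b * p.1) =
      (gaussianReal 0 1).map (fun x => Real.sqrt (a ^ 2 + b ^ 2) * x) := by
  have h1 : ((gaussianReal 0 1).prod (gaussianReal 0 1)).map
      (fun p : ℝ × ℝ => a * p.2 + b * p.1) =
      ((gaussianReal 0 1).map (b * ·)).conv ((gaussianReal 0 1).map (a * ·)) := by
    rw [Measure.conv, Measure.map_prod_map _ _ (by fun_prop) (by fun_prop),
      Measure.map_map (by fun_prop) (by fun_prop)]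
    congr 1
    ext p
    simp [add_comm]
  rw [h1, gaussianReal_map_const_mul, gaussianReal_map_const_mul, gaussianReal_conv_gaussianReal,
    gaussianReal_map_const_mul]
  congr 1
  · simp
  · ext
    simp [Real.sq_sqrt (by positivity : 0 ≤ a ^ 2 + b ^ 2), add_comm]

lemma measureReal_gaussianReal_prod_one_lt {a b : ℝ} (h : 0 < a ^ 2 + b ^ 2) :
    ((gaussianReal 0 1).prod (gaussianReal 0 1)).real {p : ℝ × ℝ | 1 < a * p.2 + b * p.1} =
      gaussQ (1 / Real.sqrt (a ^ 2 + b ^ 2)) := by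
  have e : {p : ℝ × ℝ | 1 < a * p.2 + b * p.1} =
    (fun p : ℝ × ℝ => a * p.2 + b * p.1) ⁻¹' Set.Ioi 1 := rfl
  rw [e, ← map_measureReal_apply (by fun_prop) measurableSet_Ioi, map_linear_gaussianReal_prod,
    map_measureReal_apply (by fun_prop) measurableSet_Ioi, ← measureReal_gaussianReal_Ioi]
  congr 1
  ext x
  simp only [Set.mem_preimage, Set.mem_Ioi]
  rw [div_lt_iff₀ (Real.sqrt_pos.2 h), mul_comm]

lemma integral_mul_softThresh_prod {m : ℝ} (hm : 0 < m) (s : ℝ) :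
    ∫ p : ℝ × ℝ, p.1 * softThresh (s * p.2 + m * p.1) m
        ∂((gaussianReal 0 1).prod (gaussianReal 0 1)) =
      2 * gaussQ (1 / Real.sqrt (s ^ 2 + m ^ 2)) := by
  have slice {S : Set (ℝ × ℝ)} (hS : MeasurableSet S) :
      Integrable (fun z => (gaussianReal 0 1).real {x | (x, z) ∈ S}) (gaussianReal 0 1) ∧
      ∫ z, (gaussianReal 0 1).real {x | (x, z) ∈ S} ∂gaussianReal 0 1 =
        ((gaussianReal 0 1).prod (gaussianReal 0 1)).real S := by
    have hi : Integrable (S.indicator fun _ => (1 : ℝ))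
      ((gaussianReal 0 1).prod (gaussianReal 0 1)) := (integrable_const 1).indicator hS
    have key (z : ℝ) : ∫ x, S.indicator (fun _ => (1 : ℝ)) (x, z) ∂gaussianReal 0 1 =
        (gaussianReal 0 1).real {x | (x, z) ∈ S} :=
      integral_indicator_one (measurable_prodMk_right hS)
    have h1 := hi.integral_prod_right
    have h2 := integral_prod_symm _ hi
    simp_rw [key] at h1 h2
    exact ⟨h1, h2.symm.trans (integral_indicator_one hS)⟩
  have m1 : MeasurableSet {p : ℝ × ℝ | 1 < s * p.2 + m * p.1} :=
    measurableSet_lt (by fun_prop) (by fun_prop)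
  have m2 : MeasurableSet {p : ℝ × ℝ | s * p.2 + m * p.1 < -1} :=
    measurableSet_lt (by fun_prop) (by fun_prop)
  have e : {p : ℝ × ℝ | s * p.2 + m * p.1 < -1} = {p | 1 < -s * p.2 + -m * p.1} := by
    ext p
    simp only [Set.mem_ofPred_eq]
    constructor <;> intro <;> linarith
  have hp : 0 < s ^ 2 + m ^ 2 := by positivity
  rw [integral_prod_symm _ (integrable_mul_softThresh_prod hm s)]
  simp_rw [integral_mul_softThresh_gaussianReal hm]
  refine (integral_add (slice m1).1 (slice m2).1).trans ?_
  rw [(slice m1).2, (slice m2).2, e, measureReal_gaussianReal_prod_one_lt hp,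
    measureReal_gaussianReal_prod_one_lt (by simpa using hp), neg_sq, neg_sq]
  ring

/-- `E[x⁰·x̂(√χ̂·z + m̂·x⁰; m̂)] = 2ρ·𝒬(1/√(χ̂+m̂²))` for `x⁰ ~ μ_ρ` and an
independent standard Gaussian `z`. -/
theorem stmt_3 (ρ mh χh : ℝ) (hρ : ρ ∈ Set.Icc (0 : ℝ) 1) (hm : 0 < mh) (hχ : 0 < χh) :
    ∫ p : ℝ × ℝ, p.1 * softThresh (Real.sqrt χh * p.2 + mh * p.1) mh
        ∂((bgMeasure ρ).prod (gaussianReal 0 1)) =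
      2 * ρ * gaussQ (1 / Real.sqrt (χh + mh ^ 2)) := by
  have hz : (fun p : ℝ × ℝ => p.1 * softThresh (Real.sqrt χh * p.2 + mh * p.1) mh)
      =ᵐ[(Measure.dirac (0 : ℝ)).prod (gaussianReal 0 1)] 0 := by
    have hm0 : Measurable fun p : ℝ × ℝ => p.1 * softThresh (Real.sqrt χh * p.2 + mh * p.1) mh :=
      measurable_fst.mul ((measurable_softThresh mh).comp (by fun_prop))
    rw [Measure.dirac_prod, Filter.EventuallyEq,
      ae_map_iff measurable_prodMk_left.aemeasurable
        (measurableSet_eq_fun hm0 measurable_zero)]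
    simp
  have hi := integrable_mul_softThresh_prod hm (Real.sqrt χh)
  rw [bgMeasure, Measure.add_prod, Measure.prod_smul_left, Measure.prod_smul_left,
    integral_add_measure (((integrable_zero _ _ _).congr hz.symm).smul_measure ENNReal.ofReal_ne_top)
      (hi.smul_measure ENNReal.ofReal_ne_top),
    integral_smul_measure, integral_smul_measure, integral_congr_ae hz,
    integral_mul_softThresh_prod hm, Real.sq_sqrt hχ.le, ENNReal.toReal_ofReal hρ.1]
  simp only [Pi.zero_apply, integral_zero, smul_eq_mul]
  ring
end

section
/- Let Q̂ > 0 and y ∈ ℝ, and define g(x) = (Q̂/2)x² − yx + c₀(x) on ℝ, where c₀(0) = 0 and c₀(x) = 1 for x ≠ 0. If y² > 2Q̂ then g attains its unique global minimum at x = y/Q̂ with minimum value 1 − y²/(2Q̂); if y² < 2Q̂ then g attains its unique global minimum at x = 0 with minimum value 0. -/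
/-- "Zero-norm" penalty on scalars: `c₀(0) = 0` and `c₀(x) = 1` for `x ≠ 0`. -/
noncomputable def c0 (x : ℝ) : ℝ := if x = 0 then 0 else 1

/-- Completing the square in `(Q/2)x² − yx`. -/
theorem half_mul_sq_sub_mul_eq {Q : ℝ} (hQ : Q ≠ 0) (y x : ℝ) :
    Q / 2 * x ^ 2 - y * x = Q / 2 * (x - y / Q) ^ 2 - y ^ 2 / (2 * Q) := by
  field_simp
  ring

/-- for `g(x) = (Q̂/2)x² − yx + c₀(x)` with `Q̂ > 0`: if `y² > 2Q̂` then `g`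
attains its unique global minimum at `x = y/Q̂` with value `1 − y²/(2Q̂)`; if `y² < 2Q̂`
then `g` attains its unique global minimum at `x = 0` with value `0`. -/
theorem stmt_7 (Qh y : ℝ) (hQ : 0 < Qh) :
    (y ^ 2 > 2 * Qh →
      (∀ x : ℝ, x ≠ y / Qh →
        Qh / 2 * (y / Qh) ^ 2 - y * (y / Qh) + c0 (y / Qh) < Qh / 2 * x ^ 2 - y * x + c0 x) ∧
      Qh / 2 * (y / Qh) ^ 2 - y * (y / Qh) + c0 (y / Qh) = 1 - y ^ 2 / (2 * Qh)) ∧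
    (y ^ 2 < 2 * Qh →
      (∀ x : ℝ, x ≠ 0 →
        Qh / 2 * (0 : ℝ) ^ 2 - y * 0 + c0 0 < Qh / 2 * x ^ 2 - y * x + c0 x) ∧
      Qh / 2 * (0 : ℝ) ^ 2 - y * 0 + c0 0 = 0) := by
  have hsq := half_mul_sq_sub_mul_eq hQ.ne' y
  constructor
  · intro hy
    have hy0 : y ≠ 0 := by
      rintro rfl
      linarith
    have hc : c0 (y / Qh) = 1 := if_neg (div_ne_zero hy0 hQ.ne')
    have hval : Qh / 2 * (y / Qh) ^ 2 - y * (y / Qh) + c0 (y / Qh) = 1 - y ^ 2 / (2 * Qh) := by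
      rw [hsq, hc]
      ring
    refine ⟨fun x hx => ?_, hval⟩
    rw [hval]
    by_cases hx0 : x = 0
    · have h1 : 1 < y ^ 2 / (2 * Qh) := by
        rw [lt_div_iff₀ (by positivity)]
        linarith
      simp only [hx0, c0, if_true]
      linarith
    · have hpos : 0 < Qh / 2 * (x - y / Qh) ^ 2 :=
        mul_pos (half_pos hQ) (sq_pos_of_ne_zero (sub_ne_zero.mpr hx))
      rw [hsq, c0, if_neg hx0]
      linarith
  · intro hy
    have hval : Qh / 2 * (0 : ℝ) ^ 2 - y * 0 + c0 0 = 0 := by simp [c0]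
    refine ⟨fun x hx => ?_, hval⟩
    have h1 : y ^ 2 / (2 * Qh) < 1 := by
      rw [div_lt_one (by positivity)]
      exact hy
    have hnn : 0 ≤ Qh / 2 * (x - y / Qh) ^ 2 := by positivity
    rw [hval, hsq, c0, if_neg hx]
    linarith
end

section
/- Let ρ ∈ [0,1], m̂ > 0 and χ̂ > 0. Let x⁰ be distributed according to the Bernoulli–Gaussian measure μ_ρ and let z be an independent standard Gaussian random variable. Then E[ x⁰ · x̂₀(√χ̂·z + m̂·x⁰; m̂) ] = 2ρ·r₀( m̂/(m̂² + χ̂) ). -/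
open MeasureTheory ProbabilityTheory

/-- `r₀(h) = e^{−h}·√(h/π) + 𝒬(√(2h))`. -/
noncomputable def r0Fun (h : ℝ) : ℝ :=
  Real.exp (-h) * Real.sqrt (h / Real.pi) + gaussQ (Real.sqrt (2 * h))

/-- Hard-thresholding function: `x̂₀(y; m̂) = y/m̂` if `|y| > √(2m̂)` and `0` otherwise. -/
noncomputable def hardThresh (y mh : ℝ) : ℝ :=
  if Real.sqrt (2 * mh) < |y| then y / mh else 0

open Filter Topology

/-- Truncated second moment of the standard Gaussian density on a half-line. -/
lemma setIntegral_Ioi_sq_mul_gaussian (a : ℝ) :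
    ∫ x in Set.Ioi a, x ^ 2 * (Real.exp (-x ^ 2 / 2) / Real.sqrt (2 * Real.pi)) =
      a * (Real.exp (-a ^ 2 / 2) / Real.sqrt (2 * Real.pi)) + gaussQ a := by
  have hφ : Integrable fun x : ℝ ↦ Real.exp (-x ^ 2 / 2) / Real.sqrt (2 * Real.pi) := by
    refine ((integrable_exp_neg_mul_sq (b := 1 / 2) (by norm_num)).div_const
      (Real.sqrt (2 * Real.pi))).congr (ae_of_all _ fun x ↦ ?_)
    ring_nf
  have hx2 : Integrable fun x : ℝ ↦
      x ^ 2 * (Real.exp (-x ^ 2 / 2) / Real.sqrt (2 * Real.pi)) := by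
    refine ((integrable_rpow_mul_exp_neg_mul_sq (b := 1 / 2) (s := 2) (by norm_num)
      (by norm_num)).div_const (Real.sqrt (2 * Real.pi))).congr (ae_of_all _ fun x ↦ ?_)
    simp only [Real.rpow_two]
    ring_nf
  have hderiv : ∀ x ∈ Set.Ici a, HasDerivAt
      (fun x : ℝ ↦ x * (Real.exp (-x ^ 2 / 2) / Real.sqrt (2 * Real.pi)))
      (Real.exp (-x ^ 2 / 2) / Real.sqrt (2 * Real.pi) -
        x ^ 2 * (Real.exp (-x ^ 2 / 2) / Real.sqrt (2 * Real.pi))) x := by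
    intro x _
    have h := (hasDerivAt_id x).mul
      ((((hasDerivAt_pow 2 x).neg.div_const 2).exp).div_const (Real.sqrt (2 * Real.pi)))
    refine h.congr_deriv ?_
    simp
    ring
  have hlim : Tendsto (fun x : ℝ ↦ x * (Real.exp (-x ^ 2 / 2) / Real.sqrt (2 * Real.pi)))
      atTop (𝓝 0) := by
    have h := ((tendsto_rpow_abs_mul_exp_neg_mul_sq_cocompact (a := 1 / 2) (by norm_num) 1).mono_left
      atTop_le_cocompact).div_const (Real.sqrt (2 * Real.pi))
    rw [zero_div] at h
    refine h.congr' ?_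
    filter_upwards [eventually_ge_atTop 0] with x hx
    rw [abs_of_nonneg hx, Real.rpow_one]
    ring_nf
  have h := integral_Ioi_of_hasDerivAt_of_tendsto' hderiv (hφ.sub hx2).integrableOn hlim
  rw [integral_sub hφ.integrableOn hx2.integrableOn] at h
  rw [gaussQ]
  linarith

/-- Two-sided truncated second moment of the standard Gaussian measure. -/
lemma integral_gaussianReal_sq_indicator {a : ℝ} (ha : 0 ≤ a) :
    ∫ x, (if a < |x| then x ^ 2 else 0) ∂(gaussianReal 0 1) =
      2 * (a * (Real.exp (-a ^ 2 / 2) / Real.sqrt (2 * Real.pi)) + gaussQ a) := by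
  rw [integral_gaussianReal_eq_integral_smul one_ne_zero, ← setIntegral_Ioi_sq_mul_gaussian]
  let f : ℝ → ℝ := (Set.Ioi a).indicator
    fun x ↦ x ^ 2 * (Real.exp (-x ^ 2 / 2) / Real.sqrt (2 * Real.pi))
  have hf : ∀ x : ℝ, gaussianPDFReal 0 1 x • (if a < |x| then x ^ 2 else 0) = f |x| := by
    intro x
    by_cases h : a < |x|
    · simp [f, h, gaussianPDFReal]
      ring
    · simp [f, h]
  simp_rw [hf]
  rw [integral_comp_abs, setIntegral_indicator measurableSet_Ioi,
    Set.inter_eq_right.2 (Set.Ioi_subset_Ioi ha)]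

lemma r0Fun_eq {h : ℝ} (hh : 0 ≤ h) :
    r0Fun h = Real.sqrt (2 * h) * (Real.exp (-Real.sqrt (2 * h) ^ 2 / 2) /
      Real.sqrt (2 * Real.pi)) + gaussQ (Real.sqrt (2 * h)) := by
  rw [r0Fun, Real.sq_sqrt (by positivity), Real.sqrt_mul zero_le_two, Real.sqrt_mul zero_le_two,
    Real.sqrt_div hh]
  have : Real.sqrt 2 ≠ 0 := by positivity
  have : Real.sqrt Real.pi ≠ 0 := by positivity
  field_simp

lemma measurable_hardThresh (mh : ℝ) : Measurable fun y ↦ hardThresh y mh :=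
  Measurable.ite (measurableSet_lt measurable_const measurable_norm)
    (measurable_id.div_const mh) measurable_const

lemma abs_hardThresh_le {mh : ℝ} (hm : 0 < mh) (y : ℝ) : |hardThresh y mh| ≤ |y| / mh := by
  rw [hardThresh]
  split_ifs
  · rw [abs_div, abs_of_pos hm]
  · rw [abs_zero]; positivity

lemma memLp_two_hardThresh_gaussianReal {mh : ℝ} (hm : 0 < mh) (s : ℝ) :
    MemLp (fun u ↦ hardThresh (s * u) mh) 2 (gaussianReal 0 1) := by
  refine ((memLp_id_gaussianReal' 2 (by simp)).const_mul (s / mh)).mono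
    ((measurable_hardThresh mh).comp (measurable_const_mul s)).aestronglyMeasurable
    (ae_of_all _ fun u ↦ (abs_hardThresh_le hm _).trans_eq ?_)
  simp [abs_mul, abs_of_pos hm]
  ring

/-- If `u = cos θ · x + sin θ · z`, then for independent standard Gaussians `x, z` only the
component of `x` along `u` is correlated with `f u`. -/
lemma integral_fst_mul_comp_rotation {f : ℝ → ℝ} (hf : MemLp f 2 (gaussianReal 0 1)) (θ : ℝ) :
    Integrable (fun p : ℝ × ℝ ↦ p.1 * f (Real.cos θ * p.1 + Real.sin θ * p.2))
        ((gaussianReal 0 1).prod (gaussianReal 0 1)) ∧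
      ∫ p : ℝ × ℝ, p.1 * f (Real.cos θ * p.1 + Real.sin θ * p.2)
        ∂((gaussianReal 0 1).prod (gaussianReal 0 1)) =
        Real.cos θ * ∫ u, u * f u ∂(gaussianReal 0 1) := by
  set γ := gaussianReal 0 1
  let g : ℝ × ℝ → ℝ := fun q ↦
    Real.cos θ * (q.1 * f q.1 * 1) - Real.sin θ * (f q.1 * q.2)
  have hfi : Integrable f γ := hf.integrable one_le_two
  have hid : MemLp id 2 γ := memLp_id_gaussianReal' 2 (by simp)
  have huf : Integrable (fun u ↦ u * f u) γ := hid.integrable_mul hf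
  have h1 : Integrable (fun q : ℝ × ℝ ↦ Real.cos θ * (q.1 * f q.1 * 1)) (γ.prod γ) :=
    (huf.mul_prod (integrable_const 1)).const_mul _
  have h2 : Integrable (fun q : ℝ × ℝ ↦ Real.sin θ * (f q.1 * q.2)) (γ.prod γ) :=
    (hfi.mul_prod (hid.integrable one_le_two)).const_mul _
  have hg : Integrable g (γ.prod γ) := h1.sub h2
  have hrot : (γ.prod γ).map (ContinuousLinearMap.rotation θ) = γ.prod γ :=
    IsGaussian.map_rotation_eq_self (by simp [γ]) θ
  have hmeas : AEMeasurable (ContinuousLinearMap.rotation θ : ℝ × ℝ →L[ℝ] ℝ × ℝ) (γ.prod γ) :=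
    (ContinuousLinearMap.continuous _).aemeasurable
  have hcomp : (fun p : ℝ × ℝ ↦ p.1 * f (Real.cos θ * p.1 + Real.sin θ * p.2)) =
      g ∘ (ContinuousLinearMap.rotation θ) := by
    ext p
    simp only [g, Function.comp_apply, ContinuousLinearMap.rotation_apply, smul_eq_mul]
    linear_combination (-p.1 * f (Real.cos θ * p.1 + Real.sin θ * p.2)) *
      Real.cos_sq_add_sin_sq θ
  rw [← hrot] at hg
  rw [hcomp]
  refine ⟨hg.comp_aemeasurable hmeas, ?_⟩
  change ∫ p, g (ContinuousLinearMap.rotation θ p) ∂_ = _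
  rw [← integral_map hmeas hg.aestronglyMeasurable, hrot, integral_sub h1 h2,
    integral_const_mul, integral_const_mul, integral_prod_mul (fun u ↦ u * f u) (fun _ ↦ (1 : ℝ)),
    integral_prod_mul f (fun v ↦ v)]
  simp [γ]

/-- Integration against `bgMeasure ρ` in the first variable of a function vanishing at `0`. -/
lemma integral_bgMeasure_prod {ρ : ℝ} (hρ : 0 ≤ ρ) {ν : Measure ℝ} [SFinite ν]
    {F : ℝ × ℝ → ℝ} (hF : Integrable F ((gaussianReal 0 1).prod ν)) (hmF : Measurable F)
    (h0 : ∀ z, F (0, z) = 0) :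
    ∫ p, F p ∂((bgMeasure ρ).prod ν) = ρ * ∫ p, F p ∂((gaussianReal 0 1).prod ν) := by
  have hae : F =ᵐ[(Measure.dirac (0 : ℝ)).prod ν] 0 := by
    rw [Measure.dirac_prod]
    exact (ae_map_iff measurable_prodMk_left.aemeasurable
      (measurableSet_eq_fun hmF measurable_const)).2 (ae_of_all _ h0)
  have hd : Integrable F ((Measure.dirac (0 : ℝ)).prod ν) :=
    (integrable_zero _ _ _).congr hae.symm
  rw [bgMeasure, Measure.add_prod, Measure.prod_smul_left, Measure.prod_smul_left,
    integral_add_measure (hd.smul_measure ENNReal.ofReal_ne_top)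
      (hF.smul_measure ENNReal.ofReal_ne_top), integral_smul_measure, integral_smul_measure,
    integral_congr_ae hae, ENNReal.toReal_ofReal hρ]
  simp

/-- `E[x⁰·x̂₀(√χ̂·z + m̂·x⁰; m̂)] = 2ρ·r₀(m̂/(m̂²+χ̂))` for `x⁰ ~ μ_ρ` and
an independent standard Gaussian `z`. -/
theorem stmt_10 (ρ mh χh : ℝ) (hρ : ρ ∈ Set.Icc (0 : ℝ) 1) (hm : 0 < mh) (hχ : 0 < χh) :
    ∫ p : ℝ × ℝ, p.1 * hardThresh (Real.sqrt χh * p.2 + mh * p.1) mh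
        ∂((bgMeasure ρ).prod (gaussianReal 0 1)) =
      2 * ρ * r0Fun (mh / (mh ^ 2 + χh)) := by
  have hs2 : 0 < mh ^ 2 + χh := by positivity
  set s := Real.sqrt (mh ^ 2 + χh) with hs_def
  have hs : 0 < s := Real.sqrt_pos.2 hs2
  have hss : s ^ 2 = mh ^ 2 + χh := Real.sq_sqrt hs2.le
  have hms : mh ≤ s := Real.le_sqrt_of_sq_le (by linarith)
  have hcos : Real.cos (Real.arccos (mh / s)) = mh / s :=
    Real.cos_arccos (by linarith [div_pos hm hs]) ((div_le_one hs).2 hms)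
  have hsin : Real.sin (Real.arccos (mh / s)) = Real.sqrt χh / s := by
    rw [Real.sin_arccos, show 1 - (mh / s) ^ 2 = χh / s ^ 2 by field_simp; linarith,
      Real.sqrt_div hχ.le, Real.sqrt_sq hs.le]
  have hF : (fun p : ℝ × ℝ ↦ p.1 * hardThresh (Real.sqrt χh * p.2 + mh * p.1) mh) =
      fun p : ℝ × ℝ ↦ p.1 * hardThresh (s * (Real.cos (Real.arccos (mh / s)) * p.1 +
        Real.sin (Real.arccos (mh / s)) * p.2)) mh := by
    ext p
    rw [hcos, hsin]
    congr 2
    field_simp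
    ring
  obtain ⟨hint, hval⟩ := integral_fst_mul_comp_rotation
    (memLp_two_hardThresh_gaussianReal hm s) (Real.arccos (mh / s))
  rw [← hF] at hint
  rw [integral_bgMeasure_prod hρ.1 hint
    (measurable_fst.mul ((measurable_hardThresh mh).comp (by fun_prop))) (by simp), hF, hval, hcos,
    ← integral_const_mul]
  have hthr : Real.sqrt (2 * (mh / (mh ^ 2 + χh))) = Real.sqrt (2 * mh) / s := by
    rw [← mul_div_assoc, Real.sqrt_div (by positivity)]
  have hpt : ∀ u : ℝ, mh / s * (u * hardThresh (s * u) mh) =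
      if Real.sqrt (2 * (mh / (mh ^ 2 + χh))) < |u| then u ^ 2 else 0 := by
    intro u
    simp only [hardThresh, hthr, div_lt_iff₀' hs, abs_mul, abs_of_pos hs]
    split_ifs
    · field_simp
    · simp
  simp_rw [hpt]
  rw [integral_gaussianReal_sq_indicator (Real.sqrt_nonneg _), r0Fun_eq (by positivity)]
  ring
end

section
/- Let 0 < α ≤ 1, λ > 0 and χ > 0, and suppose (λ + χ/α)² − 4λχ ≥ 0. Define Λ = [λ − χ/α + √((λ + χ/α)² − 4λχ)]/(2λχ) and G(s) = 1/(α⁻¹ − s). Then Λ ≥ 0 and Λ satisfies the fixed-point equation χ·Λ = 1 − α·(1 − λΛ·G(−λΛ)); moreover 1/χ − Λ = [λ + χ/α − √((λ + χ/α)² − 4λχ)]/(2λχ). -/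
/-- row-orthogonal ensemble. With `G(s) = 1/(α⁻¹ − s)` and
`Λ = [λ − χ/α + √((λ + χ/α)² − 4λχ)]/(2λχ)`, we have `Λ ≥ 0`, the fixed-point
equation `χ·Λ = 1 − α·(1 − λΛ·G(−λΛ))`, and
`1/χ − Λ = [λ + χ/α − √((λ + χ/α)² − 4λχ)]/(2λχ)`. -/
theorem stmt_15 (α lam χ Λ : ℝ) (hα0 : 0 < α) (hα1 : α ≤ 1) (hlam : 0 < lam) (hχ : 0 < χ)
    (hdisc : 0 ≤ (lam + χ / α) ^ 2 - 4 * lam * χ)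
    (hΛ : Λ = (lam - χ / α + Real.sqrt ((lam + χ / α) ^ 2 - 4 * lam * χ)) / (2 * lam * χ)) :
    0 ≤ Λ ∧
    χ * Λ = 1 - α * (1 - lam * Λ * (1 / (α⁻¹ - -(lam * Λ)))) ∧
    1 / χ - Λ = (lam + χ / α - Real.sqrt ((lam + χ / α) ^ 2 - 4 * lam * χ)) / (2 * lam * χ) := by
  set S := Real.sqrt ((lam + χ / α) ^ 2 - 4 * lam * χ)
  have hSsq : S ^ 2 = (lam + χ / α) ^ 2 - 4 * lam * χ := Real.sq_sqrt hdisc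
  have hχα : χ ≤ χ / α := le_div_self hχ.le hα0 hα1
  have hle : χ / α - lam ≤ S := by
    apply Real.le_sqrt_of_sq_le
    nlinarith [mul_le_mul_of_nonneg_left hχα hlam.le]
  have hΛ0 : 0 ≤ Λ := by
    rw [hΛ]
    exact div_nonneg (by linarith) (by positivity)
  have hSΛ : S = 2 * lam * χ * Λ - lam + χ / α := by
    rw [hΛ]
    field_simp
    ring
  refine ⟨hΛ0, ?_, ?_⟩
  · have hquad : α * lam * χ * Λ ^ 2 + (χ - α * lam) * Λ + (α - 1) = 0 := by
      rw [hSΛ] at hSsq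
      have hc : χ / α * α = χ := div_mul_cancel₀ χ hα0.ne'
      have hprod : 4 * lam * χ *
          (α * lam * χ * Λ ^ 2 + (χ - α * lam) * Λ + (α - 1)) = 0 := by
        linear_combination α * hSsq + (4 * lam - 4 * lam * χ * Λ) * hc
      exact (mul_eq_zero.mp hprod).resolve_left (by positivity)
    have hden : 1 + α * (lam * Λ) ≠ 0 := by positivity
    have hG : 1 / (α⁻¹ - -(lam * Λ)) = α / (1 + α * (lam * Λ)) := by
      rw [sub_neg_eq_add]
      field_simp
    rw [hG]
    field_simp
    linear_combination hquad
  · rw [hSΛ]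
    field_simp
    ring
end

section
/- Let 0 < α ≤ 1, λ > 0 and χ > 0. Define Λ = 1/χ − 1/(λ + χ/α), and for s < 0 define G_MP(s) = [α⁻¹ − 1 − s − √((α⁻¹ − 1 − s)² − 4s)]/(2s). Then Λ > 0 and Λ satisfies the fixed-point equation χ·Λ = 1 − α·(1 − λΛ·G_MP(−λΛ)). -/
/-- The Stieltjes transform of the Marčenko–Pastur law, for `s < 0`:
`G_MP(s) = [α⁻¹ − 1 − s − √((α⁻¹ − 1 − s)² − 4s)]/(2s)`. -/
noncomputable def gMP (α s : ℝ) : ℝ :=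
  (α⁻¹ - 1 - s - Real.sqrt ((α⁻¹ - 1 - s) ^ 2 - 4 * s)) / (2 * s)

/-- standard Gaussian (Marčenko–Pastur) ensemble. With
`Λ = 1/χ − 1/(λ + χ/α)` we have `Λ > 0` and the fixed-point equation
`χ·Λ = 1 − α·(1 − λΛ·G_MP(−λΛ))`. -/
theorem stmt_16 (α lam χ Λ : ℝ) (hα0 : 0 < α) (hα1 : α ≤ 1) (hlam : 0 < lam) (hχ : 0 < χ)
    (hΛ : Λ = 1 / χ - 1 / (lam + χ / α)) :
    0 < Λ ∧ χ * Λ = 1 - α * (1 - lam * Λ * gMP α (-(lam * Λ))) := by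
  have hD : 0 < α * lam + χ := by positivity
  have hΛ' : Λ = (α * lam + χ * (1 - α)) / (χ * (α * lam + χ)) := by
    have h : lam + χ / α = (α * lam + χ) / α := by field_simp
    rw [hΛ, h]
    field_simp
    ring
  have hpos : 0 < Λ := by
    have h : 0 ≤ χ * (1 - α) := mul_nonneg hχ.le (sub_nonneg.2 hα1)
    rw [hΛ']
    positivity
  refine ⟨hpos, ?_⟩
  have hp : 0 < lam * Λ := mul_pos hlam hpos
  have hg : 0 < α * lam / (α * lam + χ) := by positivity
  have hb : 0 ≤ α⁻¹ - 1 := sub_nonneg.2 ((one_le_inv₀ hα0).2 hα1)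
  have hsqrt : Real.sqrt ((α⁻¹ - 1 - -(lam * Λ)) ^ 2 - 4 * -(lam * Λ)) =
      2 * (α * lam / (α * lam + χ)) + (α⁻¹ - 1) + lam * Λ := by
    rw [Real.sqrt_eq_iff_mul_self_eq_of_pos (by linarith), hΛ']
    field_simp
    ring
  have hG : lam * Λ * gMP α (-(lam * Λ)) = α * lam / (α * lam + χ) := by
    rw [gMP, hsqrt]
    field_simp
    ring
  rw [hG, hΛ']
  field_simp
  ring
end
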